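/- arXiv:1507.01540 — 8 statements merged into one kernel-verified Lean document; each statement's English description precedes it below -/
import Mathlib

section
/- Let ΔP, A, R, π, β̄, β_, ᾱ, α_ be real numbers with β̄ ≥ 0, β_ ≥ 0, ᾱ ≥ 0, α_ ≥ 0 and π = β̄ − β_ + ᾱ − α_. Assume the feasibility conditions ΔP ≤ A and ΔP ≤ R, and the complementary slackness conditions β̄·(A − ΔP) = 0 and ᾱ·(R − ΔP) = 0. If π > 0, then ΔP = min(A, R). -/
/-- Upward case of Lemma 2 (KKT content): if the UMP is strictly positive,
the unit's re-dispatch equals its full deliverable upward generation reserve. -/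
theorem lemma2_upward (ΔP A R π β' β ᾱ α : ℝ)
    (hβ' : 0 ≤ β') (hβ : 0 ≤ β) (hᾱ : 0 ≤ ᾱ) (hα : 0 ≤ α)
    (hπ : π = β' - β + ᾱ - α)
    (hfeasA : ΔP ≤ A) (hfeasR : ΔP ≤ R)
    (hcsβ : β' * (A - ΔP) = 0) (hcsα : ᾱ * (R - ΔP) = 0)
    (hpos : 0 < π) :
    ΔP = min A R := by
  refine le_antisymm (le_min hfeasA hfeasR) ?_
  rcases mul_eq_zero.mp hcsβ with hβ0 | hA
  · rcases mul_eq_zero.mp hcsα with hα0 | hR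
    · linarith
    · exact (min_le_right A R).trans (sub_eq_zero.mp hR).le
  · exact (min_le_left A R).trans (sub_eq_zero.mp hA).le
end

section
/- Let ΔP, B, R, π, β̄, β_, ᾱ, α_ be real numbers with β̄ ≥ 0, β_ ≥ 0, ᾱ ≥ 0, α_ ≥ 0 and π = β̄ − β_ + ᾱ − α_. Assume the feasibility conditions ΔP ≥ B and ΔP ≥ −R, and the complementary slackness conditions β_·(ΔP − B) = 0 and α_·(ΔP + R) = 0. If π < 0, then ΔP = max(B, −R). -/
/-- Downward case of Lemma 2 (KKT content): if the UMP is strictly negative,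
the unit's re-dispatch equals its full deliverable downward generation reserve. -/
theorem lemma2_downward (ΔP B R π β' β ᾱ α : ℝ)
    (hβ' : 0 ≤ β') (hβ : 0 ≤ β) (hᾱ : 0 ≤ ᾱ) (hα : 0 ≤ α)
    (hπ : π = β' - β + ᾱ - α)
    (hfeasB : B ≤ ΔP) (hfeasR : -R ≤ ΔP)
    (hcsβ : β * (ΔP - B) = 0) (hcsα : α * (ΔP + R) = 0)
    (hneg : π < 0) :
    ΔP = max B (-R) := by
  refine le_antisymm ?_ (max_le hfeasB hfeasR)
  rcases mul_eq_zero.mp hcsβ with h | h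
  · rcases mul_eq_zero.mp hcsα with h' | h'
    · linarith
    · exact le_max_of_le_right (by linarith)
  · exact le_max_of_le_left (by linarith)
end

section
/- Let M (buses), L (lines), and K be finite index sets. Let Γ : L × M → ℝ, Pinj : M → ℝ with Σ_{m ∈ M} Pinj(m) = 0, F : L → ℝ, λ ∈ ℝ, and multipliers η̄, η_ : L → ℝ and η̄ᵏ, η_ᵏ : L × K → ℝ. Define the line flows f(l) = Σ_{m} Γ(l,m)·Pinj(m), the transmission reserves Δf_pos(l) = F(l) − f(l) and Δf_neg(l) = F(l) + f(l), and the prices π(m) = λ − Σ_{l} Γ(l,m)·(η̄(l) − η_(l)) − Σ_{l} Σ_{k} Γ(l,m)·(η̄ᵏ(l,k) − η_ᵏ(l,k)). Assume the complementary slackness conditions η̄(l)·Δf_pos(l) = 0 and η_(l)·Δf_neg(l) = 0 for every l ∈ L. Then −Σ_{m ∈ M} π(m)·Pinj(m) = Σ_{l ∈ L} (η̄(l) + η_(l) + Σ_{k ∈ K} (η̄ᵏ(l,k) + η_ᵏ(l,k)))·F(l) − Σ_{l ∈ L} Σ_{k ∈ K} (η̄ᵏ(l,k)·Δf_pos(l)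 + η_ᵏ(l,k)·Δf_neg(l)). -/
/-- Prices that differ from a uniform price by a combination of shift factors collect, over balanced
injections, the shadow prices times the line flows. -/
theorem neg_sum_price_mul_injection {M L : Type*} [Fintype M] [Fintype L]
    (Γ : L → M → ℝ) (p : M → ℝ) (hp : ∑ m, p m = 0) (a : ℝ) (c : L → ℝ) :
    -(∑ m, (a - ∑ l, Γ l m * c l) * p m) = ∑ l, c l * ∑ m, Γ l m * p m := by
  simp only [sub_mul, Finset.sum_sub_distrib, ← Finset.mul_sum, hp, Finset.sum_mul]
  rw [Finset.sum_comm, mul_zero, zero_sub, neg_neg]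
  refine Finset.sum_congr rfl fun l _ => ?_
  rw [Finset.mul_sum]
  exact Finset.sum_congr rfl fun m _ => by ring


open Finset in
/-- Energy congestion cost identity (33) in the proof of Theorem 1. -/
theorem energy_congestion_cost_identity
    {M L K : Type*} [Fintype M] [Fintype L] [Fintype K]
    (Γ : L → M → ℝ) (Pinj : M → ℝ) (hbal : ∑ m, Pinj m = 0)
    (F : L → ℝ) (lam : ℝ)
    (η' η : L → ℝ) (η'k ηk : L → K → ℝ)
    (f : L → ℝ) (hf : ∀ l, f l = ∑ m, Γ l m * Pinj m)
    (Δfpos Δfneg : L → ℝ)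
    (hpos : ∀ l, Δfpos l = F l - f l) (hneg : ∀ l, Δfneg l = F l + f l)
    (π : M → ℝ)
    (hπ : ∀ m, π m = lam - (∑ l, Γ l m * (η' l - η l))
        - ∑ l, ∑ k, Γ l m * (η'k l k - ηk l k))
    (hcs1 : ∀ l, η' l * Δfpos l = 0) (hcs2 : ∀ l, η l * Δfneg l = 0) :
    -(∑ m, π m * Pinj m) =
      (∑ l, (η' l + η l + ∑ k, (η'k l k + ηk l k)) * F l)
        - ∑ l, ∑ k, (η'k l k * Δfpos l + ηk l k * Δfneg l) := by
  have hprice : ∀ m, π m = lam - ∑ l, Γ l m * (η' l - η l + ∑ k, (η'k l k - ηk l k)) := by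
    intro m
    simp only [hπ, mul_add, sum_add_distrib, mul_sum]
    ring
  simp only [hprice]
  rw [neg_sum_price_mul_injection Γ Pinj hbal, ← sum_sub_distrib]
  refine sum_congr rfl fun l _ => ?_
  have hreserve : ∑ k, (η'k l k * Δfpos l + ηk l k * Δfneg l) =
      (∑ k, (η'k l k + ηk l k)) * F l - (∑ k, (η'k l k - ηk l k)) * f l := by
    rw [sum_mul, sum_mul, ← sum_sub_distrib]
    refine sum_congr rfl fun k _ => ?_
    rw [hpos, hneg]
    ring
  have h₁ := hcs1 l
  have h₂ := hcs2 l
  rw [hpos] at h₁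
  rw [hneg] at h₂
  rw [← hf, hreserve]
  linear_combination -h₁ - h₂
end

section
/- Let M (buses), L (lines), K, and W (FTR contracts) be finite index sets. Let Γ : L × M → ℝ, F : L → ℝ, λ ∈ ℝ, nonnegative multipliers η̄, η_ : L → ℝ and η̄ᵏ, η_ᵏ : L × K → ℝ (all values ≥ 0), and define the prices π(m) = λ − Σ_{l} Γ(l,m)·(η̄(l) − η_(l)) − Σ_{l} Σ_{k} Γ(l,m)·(η̄ᵏ(l,k) − η_ᵏ(l,k)). Let σ, τ : W → M and FTR : W → ℝ satisfy the simultaneous feasibility test: |Σ_{w ∈ W} (Γ(l,σ(w)) − Γ(l,τ(w)))·FTR(w)| ≤ F(l) for every l ∈ L. Then Σ_{w ∈ W} (π(σ(w)) − π(τ(w)))·FTR(w) ≤ Σ_{l ∈ L} (η̄(l) + η_(l) + Σ_{k ∈ K} (η̄ᵏ(l,k) + η_ᵏ(l,k)))·F(l). -/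
open Finset in
/-- Inequality (34) in the proof of Theorem 1: under the simultaneous feasibility test,
the total FTR credit is bounded by the full congestion rent over all lines. -/
theorem ftr_credit_bound
    {M L K W : Type*} [Fintype M] [Fintype L] [Fintype K] [Fintype W]
    (Γ : L → M → ℝ) (F : L → ℝ) (lam : ℝ)
    (η' η : L → ℝ) (η'k ηk : L → K → ℝ)
    (hη' : ∀ l, 0 ≤ η' l) (hη : ∀ l, 0 ≤ η l)
    (hη'k : ∀ l k, 0 ≤ η'k l k) (hηk : ∀ l k, 0 ≤ ηk l k)
    (π : M → ℝ)
    (hπ : ∀ m, π m = lam - (∑ l, Γ l m * (η' l - η l))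
        - ∑ l, ∑ k, Γ l m * (η'k l k - ηk l k))
    (σ τ : W → M) (FTR : W → ℝ)
    (hSFT : ∀ l, |∑ w, (Γ l (σ w) - Γ l (τ w)) * FTR w| ≤ F l) :
    ∑ w, (π (σ w) - π (τ w)) * FTR w ≤
      ∑ l, (η' l + η l + ∑ k, (η'k l k + ηk l k)) * F l := by
  set a : L → ℝ := fun l => η' l - η l + ∑ k, (η'k l k - ηk l k) with ha
  have price (m : M) : π m = lam - ∑ l, Γ l m * a l := by
    rw [hπ, sub_sub, ← sum_add_distrib]
    simp only [ha, mul_add, mul_sum]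
  have credit : ∑ w, (π (σ w) - π (τ w)) * FTR w =
      ∑ l, -a l * ∑ w, (Γ l (σ w) - Γ l (τ w)) * FTR w := by
    simp only [mul_sum]
    rw [sum_comm]
    refine sum_congr rfl fun w _ => ?_
    rw [price, price, sub_sub_sub_cancel_left, ← sum_sub_distrib, sum_mul]
    exact sum_congr rfl fun l _ => by ring
  rw [credit]
  refine sum_le_sum fun l _ => ?_
  have habs : |-a l| ≤ η' l + η l + ∑ k, (η'k l k + ηk l k) := by
    have h₁ : 0 ≤ ∑ k, η'k l k := sum_nonneg fun k _ => hη'k l k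
    have h₂ : 0 ≤ ∑ k, ηk l k := sum_nonneg fun k _ => hηk l k
    simp only [ha, sum_add_distrib, sum_sub_distrib]
    rw [abs_le]
    constructor <;> linarith [hη' l, hη l]
  calc -a l * ∑ w, (Γ l (σ w) - Γ l (τ w)) * FTR w
      ≤ |-a l| * |∑ w, (Γ l (σ w) - Γ l (τ w)) * FTR w| := by
        rw [← abs_mul]
        exact le_abs_self _
    _ ≤ (η' l + η l + ∑ k, (η'k l k + ηk l k)) * F l :=
        mul_le_mul habs (hSFT l) (abs_nonneg _) ((abs_nonneg _).trans habs)
end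

section
/- Let M (buses), L (lines), K, and W (FTR contracts) be finite index sets. Let Γ : L × M → ℝ, Pinj : M → ℝ with Σ_{m} Pinj(m) = 0, F : L → ℝ, λ ∈ ℝ, nonnegative multipliers η̄, η_ : L → ℝ and η̄ᵏ, η_ᵏ : L × K → ℝ (all values ≥ 0), and define f(l) = Σ_{m} Γ(l,m)·Pinj(m), Δf_pos(l) = F(l) − f(l), Δf_neg(l) = F(l) + f(l), and π(m) = λ − Σ_{l} Γ(l,m)·(η̄(l) − η_(l)) − Σ_{l} Σ_{k} Γ(l,m)·(η̄ᵏ(l,k) − η_ᵏ(l,k)). Assume the complementary slackness conditions η̄(l)·Δf_pos(l) = 0 and η_(l)·Δf_neg(l) = 0 for every l, and let σ, τ : W → M and FTR : W → ℝ satisfy |Σ_{w} (Γ(l,σ(w)) − Γ(l,τ(w)))·FTR(w)| ≤ F(l) for every l. Then the FTR credit exceeds the energy congestion cost by at most the transmission reserve credit: Σ_{w ∈ W} (π(σ(w)) − π(τ(w)))·FTR(w) − (−Σ_{m ∈ M} π(m)·Pinj(m)) ≤ Σ_{l ∈ L} Σ_{k ∈ K} (η̄ᵏ(l,k)·Δf_pos(l)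 + η_ᵏ(l,k)·Δf_neg(l)). -/
open Finset in
/-- Injecting `x` at prices made of an energy component `c` and a congestion component with line
multipliers `a` costs the energy component minus the multipliers weighted by the line flows. -/
theorem sum_price_mul {M L ι : Type*} [Fintype L] [Fintype ι]
    (Γ : L → M → ℝ) (a : L → ℝ) (c : ℝ) (b : ι → M) (x : ι → ℝ) :
    ∑ i, (c - ∑ l, Γ l (b i) * a l) * x i =
      c * (∑ i, x i) - ∑ l, a l * ∑ i, Γ l (b i) * x i := by
  simp only [sub_mul, sum_sub_distrib, mul_sum, sum_mul]
  rw [sum_comm]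
  congr 1
  exact sum_congr rfl fun l _ => sum_congr rfl fun i _ => by ring

open Finset in
/-- Theorem 1: the FTR credit exceeds the energy congestion cost by at most
the transmission reserve credit. -/
theorem ftr_underfunding_bound
    {M L K W : Type*} [Fintype M] [Fintype L] [Fintype K] [Fintype W]
    (Γ : L → M → ℝ) (Pinj : M → ℝ) (hbal : ∑ m, Pinj m = 0)
    (F : L → ℝ) (lam : ℝ)
    (η' η : L → ℝ) (η'k ηk : L → K → ℝ)
    (hη' : ∀ l, 0 ≤ η' l) (hη : ∀ l, 0 ≤ η l)
    (hη'k : ∀ l k, 0 ≤ η'k l k) (hηk : ∀ l k, 0 ≤ ηk l k)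
    (f : L → ℝ) (hf : ∀ l, f l = ∑ m, Γ l m * Pinj m)
    (Δfpos Δfneg : L → ℝ)
    (hpos : ∀ l, Δfpos l = F l - f l) (hneg : ∀ l, Δfneg l = F l + f l)
    (π : M → ℝ)
    (hπ : ∀ m, π m = lam - (∑ l, Γ l m * (η' l - η l))
        - ∑ l, ∑ k, Γ l m * (η'k l k - ηk l k))
    (hcs1 : ∀ l, η' l * Δfpos l = 0) (hcs2 : ∀ l, η l * Δfneg l = 0)
    (σ τ : W → M) (FTR : W → ℝ)
    (hSFT : ∀ l, |∑ w, (Γ l (σ w) - Γ l (τ w)) * FTR w| ≤ F l) :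
    (∑ w, (π (σ w) - π (τ w)) * FTR w) - (-(∑ m, π m * Pinj m)) ≤
      ∑ l, ∑ k, (η'k l k * Δfpos l + ηk l k * Δfneg l) := by
  set a : L → ℝ := fun l => (η' l - η l) + ∑ k, (η'k l k - ηk l k) with ha
  have hprice : ∀ m, π m = lam - ∑ l, Γ l m * a l := fun m => by
    simp only [hπ, ha, mul_add, sum_add_distrib, mul_sum]
    ring
  have hcredit : ∑ w, (π (σ w) - π (τ w)) * FTR w =
      -∑ l, a l * ∑ w, (Γ l (σ w) - Γ l (τ w)) * FTR w := by
    simp only [hprice, sub_mul (lam - _), sum_sub_distrib, sum_price_mul, sub_mul (Γ _ _), mul_sub]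
    ring
  have hcost : ∑ m, π m * Pinj m = -∑ l, a l * f l := by
    simp only [hprice, hf]
    simpa [hbal] using sum_price_mul Γ a lam id Pinj
  rw [hcredit, hcost, neg_neg, ← sum_neg_distrib, ← sum_sub_distrib]
  refine sum_le_sum fun l _ => ?_
  obtain ⟨hlo, hhi⟩ := abs_le.mp (hSFT l)
  set g := ∑ w, (Γ l (σ w) - Γ l (τ w)) * FTR w
  have hsplit : -(a l * g) - a l * f l =
      (η' l * (-g - f l) + η l * (g + f l)) +
        ∑ k, (η'k l k * (-g - f l) + ηk l k * (g + f l)) := by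
    simp only [ha, sum_add_distrib, sum_sub_distrib, ← sum_mul]
    ring
  have hub : -g - f l ≤ Δfpos l := by linarith [hpos l]
  have hlb : g + f l ≤ Δfneg l := by linarith [hneg l]
  have hbase : η' l * (-g - f l) + η l * (g + f l) ≤ 0 := by
    linarith [mul_le_mul_of_nonneg_left hub (hη' l), mul_le_mul_of_nonneg_left hlb (hη l),
      hcs1 l, hcs2 l]
  have hreserve : ∑ k, (η'k l k * (-g - f l) + ηk l k * (g + f l)) ≤
      ∑ k, (η'k l k * Δfpos l + ηk l k * Δfneg l) :=
    sum_le_sum fun k _ => add_le_add (mul_le_mul_of_nonneg_left hub (hη'k l k))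
      (mul_le_mul_of_nonneg_left hlb (hηk l k))
  linarith
end

section
/- Let M (buses) and L (lines) be finite index sets. Let Γ : L × M → ℝ, Pinj : M → ℝ, F : L → ℝ, λ ∈ ℝ, multipliers η̄ᵏ, η_ᵏ : L → ℝ, an uncertainty vector ε̂ : M → ℝ, and bus-level re-dispatch ΔG : M → ℝ with the balance condition Σ_{m} ΔG(m) = Σ_{m} ε̂(m). Define ΔPinj(m) = ΔG(m) − ε̂(m), f(l) = Σ_{m} Γ(l,m)·Pinj(m), Δf_pos(l) = F(l) − f(l), Δf_neg(l) = F(l) + f(l), and the prices π(m) = λ − Σ_{l} Γ(l,m)·(η̄ᵏ(l) − η_ᵏ(l)). Assume the complementary slackness conditions η̄ᵏ(l)·(F(l) − Σ_{m} Γ(l,m)·(Pinj(m) + ΔPinj(m))) = 0 and η_ᵏ(l)·(F(l) + Σ_{m} Γ(l,m)·(Pinj(m) + ΔPinj(m))) = 0 for every l ∈ L. Then Σ_{m ∈ M} π(m)·ε̂(m) = Σ_{m ∈ M} π(m)·ΔG(m) + Σ_{l ∈ L} (η̄ᵏ(l)·Δf_pos(l) + η_ᵏ(l)·Δf_neg(l)).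 -/
open Finset in
/-- Central identity in the proof of Theorem 2: for one worst-case extreme point,
the uncertainty payment equals the generation reserve credit plus the transmission
reserve credit. -/
theorem uncertainty_payment_identity_single
    {M L : Type*} [Fintype M] [Fintype L]
    (Γ : L → M → ℝ) (Pinj : M → ℝ) (F : L → ℝ) (lam : ℝ)
    (η'k ηk : L → ℝ) (ε ΔG : M → ℝ)
    (hbal : ∑ m, ΔG m = ∑ m, ε m)
    (ΔPinj : M → ℝ) (hΔPinj : ∀ m, ΔPinj m = ΔG m - ε m)
    (f : L → ℝ) (hf : ∀ l, f l = ∑ m, Γ l m * Pinj m)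
    (Δfpos Δfneg : L → ℝ)
    (hpos : ∀ l, Δfpos l = F l - f l) (hneg : ∀ l, Δfneg l = F l + f l)
    (π : M → ℝ)
    (hπ : ∀ m, π m = lam - ∑ l, Γ l m * (η'k l - ηk l))
    (hcs1 : ∀ l, η'k l * (F l - ∑ m, Γ l m * (Pinj m + ΔPinj m)) = 0)
    (hcs2 : ∀ l, ηk l * (F l + ∑ m, Γ l m * (Pinj m + ΔPinj m)) = 0) :
    ∑ m, π m * ε m =
      (∑ m, π m * ΔG m) + ∑ l, (η'k l * Δfpos l + ηk l * Δfneg l) := by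
  have hcredit : ∀ l, η'k l * Δfpos l + ηk l * Δfneg l =
      ∑ m, Γ l m * (η'k l - ηk l) * ΔPinj m := by
    intro l
    have h₁ := hcs1 l
    have h₂ := hcs2 l
    simp only [mul_add, sum_add_distrib, ← hf] at h₁ h₂
    have hfactor : ∑ m, Γ l m * (η'k l - ηk l) * ΔPinj m =
        (η'k l - ηk l) * ∑ m, Γ l m * ΔPinj m := by
      rw [mul_sum]
      exact sum_congr rfl fun m _ => by ring
    rw [hfactor, hpos, hneg]
    linear_combination h₁ + h₂
  have hprice : ∀ m, π m * ε m = π m * ΔG m - lam * (ΔG m - ε m) +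
      ∑ l, Γ l m * (η'k l - ηk l) * ΔPinj m := by
    intro m
    rw [← sum_mul, hΔPinj]
    linear_combination (ε m - ΔG m) * hπ m
  rw [sum_congr rfl fun m _ => hprice m, sum_congr rfl fun l _ => hcredit l,
    sum_add_distrib, sum_sub_distrib, ← mul_sum, sum_sub_distrib, hbal, sum_comm]
  ring
end

section
/- Let M (buses), L (lines), and K be finite index sets. Let Γ : L × M → ℝ, Pinj : M → ℝ, F : L → ℝ, and for each k ∈ K: λᵏ ∈ ℝ, multipliers η̄ᵏ, η_ᵏ : L → ℝ, uncertainty vector ε̂ᵏ : M → ℝ, and re-dispatch ΔGᵏ : M → ℝ with Σ_{m} ΔGᵏ(m) = Σ_{m} ε̂ᵏ(m). Define ΔPinjᵏ(m) = ΔGᵏ(m) − ε̂ᵏ(m), f(l) = Σ_{m} Γ(l,m)·Pinj(m), Δf_pos(l) = F(l) − f(l), Δf_neg(l) = F(l) + f(l), and πᵏ(m) = λᵏ − Σ_{l} Γ(l,m)·(η̄ᵏ(l) − η_ᵏ(l)). Assume for every k ∈ K and l ∈ L the complementary slackness conditions η̄ᵏ(l)·(F(l) − Σ_{m} Γ(l,m)·(Pinj(m)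 + ΔPinjᵏ(m))) = 0 and η_ᵏ(l)·(F(l) + Σ_{m} Γ(l,m)·(Pinj(m) + ΔPinjᵏ(m))) = 0. Then the total uncertainty payment exactly covers the generation reserve credit and the transmission reserve credit: Σ_{k ∈ K} Σ_{m ∈ M} πᵏ(m)·ε̂ᵏ(m) = Σ_{k ∈ K} Σ_{m ∈ M} πᵏ(m)·ΔGᵏ(m) + Σ_{l ∈ L} Σ_{k ∈ K} (η̄ᵏ(l)·Δf_pos(l) + η_ᵏ(l)·Δf_neg(l)). -/
open Finset in
/-- Theorem 2 (main assertion): the total uncertainty payment exactly covers the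
generation reserve credit and the transmission reserve credit. -/
theorem uncertainty_payment_covers_credits
    {M L K : Type*} [Fintype M] [Fintype L] [Fintype K]
    (Γ : L → M → ℝ) (Pinj : M → ℝ) (F : L → ℝ)
    (lam : K → ℝ) (η'k ηk : K → L → ℝ)
    (ε ΔG : K → M → ℝ)
    (hbal : ∀ k, ∑ m, ΔG k m = ∑ m, ε k m)
    (ΔPinj : K → M → ℝ) (hΔPinj : ∀ k m, ΔPinj k m = ΔG k m - ε k m)
    (f : L → ℝ) (hf : ∀ l, f l = ∑ m, Γ l m * Pinj m)
    (Δfpos Δfneg : L → ℝ)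
    (hpos : ∀ l, Δfpos l = F l - f l) (hneg : ∀ l, Δfneg l = F l + f l)
    (π : K → M → ℝ)
    (hπ : ∀ k m, π k m = lam k - ∑ l, Γ l m * (η'k k l - ηk k l))
    (hcs1 : ∀ k l, η'k k l * (F l - ∑ m, Γ l m * (Pinj m + ΔPinj k m)) = 0)
    (hcs2 : ∀ k l, ηk k l * (F l + ∑ m, Γ l m * (Pinj m + ΔPinj k m)) = 0) :
    ∑ k, ∑ m, π k m * ε k m =
      (∑ k, ∑ m, π k m * ΔG k m)
        + ∑ l, ∑ k, (η'k k l * Δfpos l + ηk k l * Δfneg l) := by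
  rw [sum_comm (s := (univ : Finset L)), ← sum_add_distrib]
  refine sum_congr rfl fun k _ => ?_
  have hbal₀ : ∑ m, ΔPinj k m = 0 := by
    simp only [hΔPinj, sum_sub_distrib, hbal, sub_self]
  have hcredit : ∀ l, η'k k l * Δfpos l + ηk k l * Δfneg l =
      ∑ m, Γ l m * (η'k k l - ηk k l) * ΔPinj k m := by
    intro l
    have h₁ := hcs1 k l
    have h₂ := hcs2 k l
    simp only [mul_add, sum_add_distrib, ← hf] at h₁ h₂
    have hfactor : ∑ m, Γ l m * (η'k k l - ηk k l) * ΔPinj k m =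
        (η'k k l - ηk k l) * ∑ m, Γ l m * ΔPinj k m := by
      rw [mul_sum]
      exact sum_congr rfl fun m _ => by ring
    rw [hfactor, hpos, hneg]
    linear_combination h₁ + h₂
  have hpay : ∑ m, π k m * ΔPinj k m =
      -∑ l, ∑ m, Γ l m * (η'k k l - ηk k l) * ΔPinj k m := by
    simp only [hπ, sub_mul, sum_sub_distrib, ← mul_sum, hbal₀, mul_zero, zero_sub, sum_mul]
    rw [sum_comm]
  have hsplit : ∑ m, π k m * ΔPinj k m = ∑ m, π k m * ΔG k m - ∑ m, π k m * ε k m := by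
    simp only [hΔPinj, mul_sub, sum_sub_distrib]
  simp only [hcredit]
  linarith
end

section
/- Let n be a positive integer, u ∈ ℝⁿ with u_i > 0 for all i, and Λ a nonnegative integer. Consider the polytope U = {ε ∈ ℝⁿ : −u_i ≤ ε_i ≤ u_i for all i, and Σ_{i=1}^{n} |ε_i|/u_i ≤ Λ}. Then every extreme point ε of U satisfies ε_i ∈ {−u_i, 0, u_i} for every i. -/
/-- An extreme point of a budget set admits no nontrivial componentwise rescaling that keeps both
`ε * (1 + c)` and `ε * (1 - c)` inside the set. -/
theorem eq_zero_of_rescaling_of_mem_extremePoints {ι : Type*} [Fintype ι] {u : ι → ℝ}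
    (hu : ∀ i, 0 < u i) {L : ℝ} {ε : ι → ℝ}
    (hε : ε ∈ Set.extremePoints ℝ {ε : ι → ℝ |
        (∀ i, -u i ≤ ε i ∧ ε i ≤ u i) ∧ (∑ i, |ε i| / u i ≤ L)})
    (c : ι → ℝ) (hc : ∀ i, |c i| ≤ 1) (hbox : ∀ i, |ε i| / u i * (1 + |c i|) ≤ 1)
    (hsum : ∑ i, |ε i| / u i + |∑ i, |ε i| / u i * c i| ≤ L) (i : ι) : ε i * c i = 0 := by
  have key : ∀ e : ι → ℝ, (∀ i, |e i| ≤ |c i|) →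
      ∑ i, |ε i| / u i * e i ≤ |∑ i, |ε i| / u i * c i| →
      (fun i => ε i * (1 + e i)) ∈ {ε : ι → ℝ |
        (∀ i, -u i ≤ ε i ∧ ε i ≤ u i) ∧ (∑ i, |ε i| / u i ≤ L)} := by
    intro e he hes
    have habs : ∀ i, |ε i * (1 + e i)| / u i = |ε i| / u i + |ε i| / u i * e i := by
      intro i
      have h1 : 0 ≤ 1 + e i := by linarith [neg_abs_le (e i), he i, hc i]
      rw [abs_mul, abs_of_nonneg h1]
      ring
    refine ⟨fun i => abs_le.mp ?_, ?_⟩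
    · rw [← div_le_one (hu i), habs]
      have h0 : 0 ≤ |ε i| / u i := div_nonneg (abs_nonneg _) (hu i).le
      have := mul_le_mul_of_nonneg_left ((le_abs_self (e i)).trans (he i)) h0
      linarith [hbox i]
    · simp only [habs, Finset.sum_add_distrib]
      linarith
  have hp := key c (fun _ => le_rfl) (le_abs_self _)
  have hm := key (fun i => -c i) (fun i => (abs_neg _).le) (by
    simpa only [mul_neg, Finset.sum_neg_distrib] using neg_le_abs _)
  have h := hε.2 hp hm ⟨1 / 2, 1 / 2, by norm_num, by norm_num, by norm_num, by
    ext i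
    simp only [Pi.add_apply, Pi.smul_apply, smul_eq_mul]
    ring⟩
  have := congrFun h i
  linarith

open Finset in
/-- Extreme points of the budget uncertainty set with integer budget have
components in `{-u i, 0, u i}`. -/
theorem extreme_points_of_budget_uncertainty_set
    (n : ℕ) (hn : 0 < n) (u : Fin n → ℝ) (hu : ∀ i, 0 < u i) (Λ : ℕ)
    (U : Set (Fin n → ℝ))
    (hU : U = {ε : Fin n → ℝ |
        (∀ i, -u i ≤ ε i ∧ ε i ≤ u i) ∧ (∑ i, |ε i| / u i ≤ (Λ : ℝ))})
    (ε : Fin n → ℝ) (hε : ε ∈ Set.extremePoints ℝ U) :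
    ∀ i, ε i = -u i ∨ ε i = 0 ∨ ε i = u i := by
  subst hU
  intro i
  have hrescale := eq_zero_of_rescaling_of_mem_extremePoints hu hε
  obtain ⟨hbox, hsum⟩ := hε.1
  set a : Fin n → ℝ := fun k => |ε k| / u k with ha
  have ha0 : ∀ k, 0 ≤ a k := fun k => div_nonneg (abs_nonneg _) (hu k).le
  have ha1 : ∀ k, a k ≤ 1 := fun k => (div_le_one (hu k)).mpr (abs_le.mpr (hbox k))
  have hε0 : ∀ k, a k ≠ 0 → ε k ≠ 0 := fun k hk h => hk (by simp [ha, h])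
  change ∑ k, a k ≤ Λ at hsum
  change ∀ c : Fin n → ℝ, (∀ k, |c k| ≤ 1) → (∀ k, a k * (1 + |c k|) ≤ 1) →
    ∑ k, a k + |∑ k, a k * c k| ≤ Λ → ∀ k, ε k * c k = 0 at hrescale
  suffices h : a i = 0 ∨ a i = 1 by
    rcases h with h | h
    · right; left
      by_contra hne
      exact (div_pos (abs_pos.mpr hne) (hu i)).ne' h
    · rw [ha] at h
      rcases eq_or_eq_neg_of_abs_eq ((div_eq_one_iff_eq (hu i).ne').mp h) with h | h <;> simp [h]
  by_contra! hi
  have hi0 : 0 < a i := (ha0 i).lt_of_ne' hi.1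
  have hi1 : a i < 1 := (ha1 i).lt_of_ne hi.2
  by_cases hj : ∃ j, j ≠ i ∧ a j ≠ 0 ∧ a j ≠ 1
  · obtain ⟨j, hji, hj0, hj1⟩ := hj
    replace hj0 : 0 < a j := (ha0 j).lt_of_ne' hj0
    replace hj1 : a j < 1 := (ha1 j).lt_of_ne hj1
    obtain ⟨δ, hδ, hδ'⟩ : ∃ δ, 0 < δ ∧ δ ≤ a i ∧ δ ≤ 1 - a i ∧ δ ≤ a j ∧ δ ≤ 1 - a j :=
      ⟨min (min (a i) (1 - a i)) (min (a j) (1 - a j)),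
        lt_min (lt_min hi0 (sub_pos.mpr hi1)) (lt_min hj0 (sub_pos.mpr hj1)), by simp⟩
    obtain ⟨h1, h2, h3, h4⟩ := hδ'
    have hci : |δ / a i| = δ / a i := abs_of_pos (div_pos hδ hi0)
    have hcj : |δ / a j| = δ / a j := abs_of_pos (div_pos hδ hj0)
    have hzero := hrescale (Pi.single i (δ / a i) - Pi.single j (δ / a j)) ?_ ?_ ?_ i
    · simp [hji.symm, hε0 i hi.1, hδ.ne', hi0.ne'] at hzero
    · intro k
      rcases eq_or_ne k i with rfl | hki
      · simpa [hji.symm, hci] using (div_le_one hi0).mpr h1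
      rcases eq_or_ne k j with rfl | hkj
      · simpa [hki, hcj] using (div_le_one hj0).mpr h3
      · simp [hki, hkj]
    · intro k
      rcases eq_or_ne k i with rfl | hki
      · simp only [Pi.sub_apply, Pi.single_eq_same, Pi.single_eq_of_ne hji.symm, sub_zero, hci,
          mul_add, mul_one, mul_div_cancel₀ _ hi0.ne']
        linarith
      rcases eq_or_ne k j with rfl | hkj
      · simp only [Pi.sub_apply, Pi.single_eq_same, Pi.single_eq_of_ne hki, zero_sub, abs_neg, hcj,
          mul_add, mul_one, mul_div_cancel₀ _ hj0.ne']
        linarith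
      · simpa [hki, hkj] using ha1 k
    · have : ∑ k, a k * (Pi.single i (δ / a i) - Pi.single j (δ / a j) : Fin n → ℝ) k = 0 := by
        simp [mul_sub, Finset.sum_sub_distrib, Pi.single_apply, mul_div_cancel₀ _ hi0.ne',
          mul_div_cancel₀ _ hj0.ne']
      rw [this]
      simpa using hsum
  · push Not at hj
    obtain ⟨m, hm⟩ : ∃ m : ℕ, ∑ k ∈ univ.erase i, a k = m := by
      refine ⟨#{k ∈ univ.erase i | a k ≠ 0}, ?_⟩
      rw [Finset.card_filter, Nat.cast_sum]
      refine Finset.sum_congr rfl fun k hk => ?_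
      by_cases h : a k = 0
      · simp [h]
      · simp [hj k (Finset.ne_of_mem_erase hk) h]
    have hsplit : ∑ k, a k = a i + m := by
      rw [← hm, Finset.add_sum_erase _ _ (mem_univ i)]
    have hmΛ : (m : ℝ) + 1 ≤ Λ := by
      have : (m : ℝ) < Λ := by linarith
      exact_mod_cast this
    obtain ⟨δ, hδ, h1, h2⟩ : ∃ δ, 0 < δ ∧ δ ≤ a i ∧ δ ≤ 1 - a i :=
      ⟨min (a i) (1 - a i), lt_min hi0 (sub_pos.mpr hi1), by simp⟩
    have hci : |δ / a i| = δ / a i := abs_of_pos (div_pos hδ hi0)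
    have hzero := hrescale (Pi.single i (δ / a i)) ?_ ?_ ?_ i
    · simp [hε0 i hi.1, hδ.ne', hi0.ne'] at hzero
    · intro k
      rcases eq_or_ne k i with rfl | hki
      · simpa [hci] using (div_le_one hi0).mpr h1
      · simp [hki]
    · intro k
      rcases eq_or_ne k i with rfl | hki
      · simp only [Pi.single_eq_same, hci, mul_add, mul_one, mul_div_cancel₀ _ hi0.ne']
        linarith
      · simpa [hki] using ha1 k
    · have : ∑ k, a k * (Pi.single i (δ / a i) : Fin n → ℝ) k = δ := by
        simp [Pi.single_apply, mul_div_cancel₀ _ hi0.ne']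
      rw [this, abs_of_pos hδ]
      linarith
end
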